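/- Let ρ = (f, g, h) be a reduction from (Ĉ, d̂) to (C, d) and let δ̂ be a perturbation of d̂ satisfying the nilpotency hypothesis of the Basic Perturbation Lemma (for every q and every x ∈ Ĉ_q there exists ν with (h ∘ δ̂)^ν(x) = 0), and let φ = Σ_{i≥0} (−1)^i (h ∘ δ̂)^i and ψ = Σ_{i≥0} (−1)^i (δ̂ ∘ h)^i be the pointwise-finite series. If δ̂ ∘ g = 0 (or symmetrically f ∘ δ̂ = 0), then the induced perturbation of the small differential is null: δ := f ∘ δ̂ ∘ φ ∘ g = f ∘ ψ ∘ δ̂ ∘ g = 0, so that the triple (f ∘ ψ, φ ∘ g, h ∘ ψ) is a reduction from the perturbed complex (Ĉ, d̂ + δ̂) onto the unchanged small complex (C, d). -/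

import Mathlib

/-!
Common setup: chain complexes of `R`-modules indexed by `ℤ`.

We index differentials so that `C.d q : C.X (q+1) →ₗ[R] C.X q` is the differential
going out of degree `q+1`; since `q` ranges over all of `ℤ`, this gives the
differential at every degree.
-/

universe u

/-- A chain complex of `R`-modules: a `ℤ`-indexed family of `R`-modules together with
`R`-linear differentials `d : C_{q+1} → C_q` satisfying `d ∘ d = 0`. -/
structure ChainCpx (R : Type u) [CommRing R] : Type (u + 1) where
  X : ℤ → Type u
  acg : ∀ q, AddCommGroup (X q)
  mod : ∀ q, Module R (X q)
  d : ∀ q : ℤ, X (q + 1) →ₗ[R] X q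
  dd : ∀ (q : ℤ) (x : X (q + 1 + 1)), d q (d (q + 1) x) = 0

attribute [instance] ChainCpx.acg ChainCpx.mod

variable {R : Type u} [CommRing R]

/-- A reduction `ρ = (f, g, h)` from a chain complex `Cbig` to a chain complex `Csmall`:
`f`, `g` are chain maps, `h` is a degree `+1` homotopy operator on `Cbig`, satisfying
`f ∘ g = id`, `g ∘ f + d ∘ h + h ∘ d = id`, `f ∘ h = 0`, `h ∘ g = 0`, `h ∘ h = 0`. -/
structure Reduction (Cbig Csmall : ChainCpx R) where
  f : ∀ q : ℤ, Cbig.X q →ₗ[R] Csmall.X q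
  g : ∀ q : ℤ, Csmall.X q →ₗ[R] Cbig.X q
  h : ∀ q : ℤ, Cbig.X q →ₗ[R] Cbig.X (q + 1)
  f_chain : ∀ (q : ℤ) (x : Cbig.X (q + 1)), Csmall.d q (f (q + 1) x) = f q (Cbig.d q x)
  g_chain : ∀ (q : ℤ) (y : Csmall.X (q + 1)), Cbig.d q (g (q + 1) y) = g q (Csmall.d q y)
  fg : ∀ (q : ℤ) (y : Csmall.X q), f q (g q y) = y
  gf_dh_hd : ∀ (q : ℤ) (x : Cbig.X (q + 1)),
    g (q + 1) (f (q + 1) x) + Cbig.d (q + 1) (h (q + 1) x) + h q (Cbig.d q x) = x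
  fh : ∀ (q : ℤ) (x : Cbig.X q), f (q + 1) (h q x) = 0
  hg : ∀ (q : ℤ) (y : Csmall.X q), h q (g q y) = 0
  hh : ∀ (q : ℤ) (x : Cbig.X q), h (q + 1) (h q x) = 0


/-- A perturbation of the differential of a chain complex: a degree `-1` family `δ` of
`R`-linear maps such that `(d + δ) ∘ (d + δ) = 0`. -/
def IsPerturbation (C : ChainCpx R) (δ : ∀ q : ℤ, C.X (q + 1) →ₗ[R] C.X q) : Prop :=
  ∀ (q : ℤ) (x : C.X (q + 1 + 1)), (C.d q + δ q) ((C.d (q + 1) + δ (q + 1)) x) = 0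

/-- The chain complex obtained by perturbing the differential of `C` by `δ`. -/
def perturb (C : ChainCpx R) (δ : ∀ q : ℤ, C.X (q + 1) →ₗ[R] C.X q)
    (hδ : IsPerturbation C δ) : ChainCpx R where
  X := C.X
  acg := C.acg
  mod := C.mod
  d q := C.d q + δ q
  dd := hδ

/-- Partial sums of the alternating geometric series of an endomorphism telescope. -/
theorem sum_neg_one_pow_smul_add_apply {M : Type*} [AddCommGroup M] [Module R M]
    (a : M →ₗ[R] M) (x : M) (n : ℕ) :
    (∑ i ∈ Finset.range n, ((-1 : ℤ) ^ i) • (a ^ i) x) +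
      a (∑ i ∈ Finset.range n, ((-1 : ℤ) ^ i) • (a ^ i) x) = x - ((-1 : ℤ) ^ n) • (a ^ n) x := by
  induction n with
  | zero => simp
  | succ n ih =>
    rw [Finset.sum_range_succ, map_add, add_add_add_comm, ih, map_zsmul, pow_succ' a,
      Module.End.mul_apply, pow_succ (-1 : ℤ), mul_neg_one, neg_smul]
    abel

/-- The pointwise-finite series `∑ (-1)^i a^i` is a right inverse of `1 + a`. -/
theorem alternating_series_add_apply {M : Type*} [AddCommGroup M] [Module R M]
    (a p : M →ₗ[R] M) (ha : ∀ x, ∃ n : ℕ, (a ^ n) x = 0)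
    (hp : ∀ (x : M) (n : ℕ), (a ^ n) x = 0 →
      p x = ∑ i ∈ Finset.range n, ((-1 : ℤ) ^ i) • (a ^ i) x) (x : M) :
    p x + a (p x) = x := by
  obtain ⟨n, hn⟩ := ha x
  rw [hp x n hn, sum_neg_one_pow_smul_add_apply, hn, smul_zero, sub_zero]

/-- The pointwise-finite series `∑ (-1)^i a^i` is a left inverse of `1 + a`. -/
theorem alternating_series_apply_add {M : Type*} [AddCommGroup M] [Module R M]
    (a p : M →ₗ[R] M) (ha : ∀ x, ∃ n : ℕ, (a ^ n) x = 0)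
    (hp : ∀ (x : M) (n : ℕ), (a ^ n) x = 0 →
      p x = ∑ i ∈ Finset.range n, ((-1 : ℤ) ^ i) • (a ^ i) x) (x : M) :
    p (x + a x) = x := by
  have comm (i : ℕ) : (a ^ i) (a x) = a ((a ^ i) x) := by
    rw [← Module.End.mul_apply, ← Module.End.mul_apply, ← pow_succ, ← pow_succ']
  obtain ⟨n, hn⟩ := ha x
  have hn' : (a ^ n) (a x) = 0 := by rw [comm, hn, map_zero]
  have key : p (a x) = a (p x) := by
    rw [hp _ n hn', hp _ n hn, map_sum]
    exact Finset.sum_congr rfl fun i _ => by rw [comm, map_zsmul]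
  rw [map_add, key, alternating_series_add_apply a p ha hp]

/-- Pointwise nilpotency of `u ∘ v` implies pointwise nilpotency of `v ∘ u`. -/
theorem exists_pow_comp_apply_eq_zero {M N : Type*} [AddCommGroup M] [Module R M]
    [AddCommGroup N] [Module R N] (u : M →ₗ[R] N) (v : N →ₗ[R] M)
    (huv : ∀ y, ∃ n : ℕ, ((u.comp v) ^ n) y = 0) (x : M) :
    ∃ n : ℕ, ((v.comp u) ^ n) x = 0 := by
  have intertwine (n : ℕ) (z : M) : u (((v.comp u) ^ n) z) = ((u.comp v) ^ n) (u z) := by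
    induction n with
    | zero => simp
    | succ n ih =>
      rw [pow_succ', pow_succ', Module.End.mul_apply, Module.End.mul_apply, ← ih]
      rfl
  obtain ⟨n, hn⟩ := huv (u x)
  refine ⟨n + 1, ?_⟩
  rw [pow_succ', Module.End.mul_apply, LinearMap.comp_apply, intertwine, hn, map_zero]

/-- A family given in all degrees `q + 1` extends to a family in all degrees. -/
theorem exists_family_of_succ {F : ℤ → Type*} (G : ∀ q, F (q + 1)) :
    ∃ g : ∀ q, F q, ∀ q, g (q + 1) = G q :=
  ⟨(Equiv.addRight (1 : ℤ)).piCongrLeft F G, fun q =>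
    (Equiv.addRight (1 : ℤ)).piCongrLeft_apply_apply F G q⟩

/-- In the situation of the Basic Perturbation Lemma (reduction `ρ = (f,g,h)` from
`(Ĉ, d̂)` to `(C, d)`, perturbation `δ̂` of `d̂` satisfying the nilpotency hypothesis,
with `φ = Σ (-1)^i (h∘δ̂)^i` and `ψ = Σ (-1)^i (δ̂∘h)^i` the pointwise-finite series),
if `δ̂ ∘ g = 0` (or symmetrically `f ∘ δ̂ = 0`), then the induced perturbation of the
small differential is null: `f∘δ̂∘φ∘g = f∘ψ∘δ̂∘g = 0`, so that `(f∘ψ, φ∘g, h∘ψ)`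
is a reduction from the perturbed complex `(Ĉ, d̂ + δ̂)` onto the *unchanged* small
chain complex `(C, d)`. -/
theorem statement9 (Cbig Csmall : ChainCpx R) (ρ : Reduction Cbig Csmall)
    (δb : ∀ q : ℤ, Cbig.X (q + 1) →ₗ[R] Cbig.X q) (hδb : IsPerturbation Cbig δb)
    (hnil : ∀ (q : ℤ) (x : Cbig.X (q + 1)), ∃ ν : ℕ, (((ρ.h q).comp (δb q)) ^ ν) x = 0)
    (φ : ∀ q : ℤ, Cbig.X (q + 1) →ₗ[R] Cbig.X (q + 1))
    (ψ : ∀ q : ℤ, Cbig.X q →ₗ[R] Cbig.X q)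
    (hφ : ∀ (q : ℤ) (x : Cbig.X (q + 1)) (ν : ℕ), (((ρ.h q).comp (δb q)) ^ ν) x = 0 →
      φ q x = ∑ i ∈ Finset.range ν, ((-1 : ℤ) ^ i) • ((((ρ.h q).comp (δb q)) ^ i) x))
    (hψ : ∀ (q : ℤ) (x : Cbig.X q) (ν : ℕ), (((δb q).comp (ρ.h q)) ^ ν) x = 0 →
      ψ q x = ∑ i ∈ Finset.range ν, ((-1 : ℤ) ^ i) • ((((δb q).comp (ρ.h q)) ^ i) x))
    (hzero : (∀ (q : ℤ) (y : Csmall.X (q + 1)), δb q (ρ.g (q + 1) y) = 0) ∨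
      (∀ (q : ℤ) (x : Cbig.X (q + 1)), ρ.f q (δb q x) = 0)) :
    (∀ (q : ℤ) (y : Csmall.X (q + 1)), ρ.f q (δb q (φ q (ρ.g (q + 1) y))) = 0) ∧
    (∀ (q : ℤ) (y : Csmall.X (q + 1)), ρ.f q (ψ q (δb q (ρ.g (q + 1) y))) = 0) ∧
    ∃ ρ' : Reduction (perturb Cbig δb hδb) Csmall,
      (∀ q : ℤ, ρ'.f q = (ρ.f q).comp (ψ q)) ∧
      (∀ q : ℤ, ρ'.g (q + 1) = (φ q).comp (ρ.g (q + 1))) ∧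
      (∀ q : ℤ, ρ'.h q = (ρ.h q).comp (ψ q)) := by
  have hnil' (q : ℤ) := exists_pow_comp_apply_eq_zero (ρ.h q) (δb q) (hnil q)
  have φr (q : ℤ) (x : Cbig.X (q + 1)) : φ q x + ρ.h q (δb q (φ q x)) = x :=
    alternating_series_add_apply _ _ (hnil q) (hφ q) x
  have φl (q : ℤ) (x : Cbig.X (q + 1)) : φ q (x + ρ.h q (δb q x)) = x :=
    alternating_series_apply_add _ _ (hnil q) (hφ q) x
  have ψr (q : ℤ) (x : Cbig.X q) : ψ q x + δb q (ρ.h q (ψ q x)) = x :=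
    alternating_series_add_apply _ _ (hnil' q) (hψ q) x
  have ψl (q : ℤ) (x : Cbig.X q) : ψ q (x + δb q (ρ.h q x)) = x :=
    alternating_series_apply_add _ _ (hnil' q) (hψ q) x
  have φh (q : ℤ) (x : Cbig.X q) : φ q (ρ.h q x) = ρ.h q (ψ q x) := by
    conv_lhs => rw [← ψr q x, map_add (ρ.h q), φl]
  have φδ (q : ℤ) (x : Cbig.X (q + 1)) : δb q (φ q x) = ψ q (δb q x) := by
    conv_rhs => rw [← φr q x, map_add (δb q), ψl]
  have ψh (q : ℤ) (x : Cbig.X q) : ψ (q + 1) (ρ.h q x) = ρ.h q x := by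
    simpa [ρ.hh] using ψl (q + 1) (ρ.h q x)
  have fφ (q : ℤ) (x : Cbig.X (q + 1)) : ρ.f (q + 1) (φ q x) = ρ.f (q + 1) x := by
    simpa [ρ.fh] using congrArg (ρ.f (q + 1)) (φr q x)
  have hφ' (q : ℤ) (x : Cbig.X (q + 1)) : ρ.h (q + 1) (φ q x) = ρ.h (q + 1) x := by
    simpa [ρ.hh] using congrArg (ρ.h (q + 1)) (φr q x)
  have induced (q : ℤ) (y : Csmall.X (q + 1)) : ρ.f q (ψ q (δb q (ρ.g (q + 1) y))) = 0 := by
    rcases hzero with hg | hf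
    · simp [hg]
    · rw [← φδ, hf]
  have induced' (q : ℤ) (y : Csmall.X (q + 1)) : ρ.f q (δb q (φ q (ρ.g (q + 1) y))) = 0 := by
    rw [φδ, induced]
  have sq (q : ℤ) (x : Cbig.X (q + 1 + 1)) : Cbig.d q (δb (q + 1) x) +
      δb q (Cbig.d (q + 1) x) + δb q (δb (q + 1) x) = 0 := by
    have := hδb q x
    simp only [LinearMap.add_apply, map_add, Cbig.dd, zero_add] at this
    rw [← this]
    abel
  have conj_right (q : ℤ) (x : Cbig.X (q + 1)) :
      Cbig.d q (x + δb (q + 1) (ρ.h (q + 1) x)) + δb q (x + δb (q + 1) (ρ.h (q + 1) x)) =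
        Cbig.d q x + δb q (ρ.h q (Cbig.d q x)) + δb q (ρ.g (q + 1) (ρ.f (q + 1) x)) := by
    have h₁ := congrArg (δb q) (ρ.gf_dh_hd q x)
    have h₂ := sq q (ρ.h (q + 1) x)
    simp only [map_add] at h₁ ⊢
    linear_combination (norm := abel) h₂ - h₁
  have conj_left (q : ℤ) (x : Cbig.X (q + 1 + 1)) :
      Cbig.d (q + 1) x + δb (q + 1) x + ρ.h q (δb q (Cbig.d (q + 1) x + δb (q + 1) x)) =
        Cbig.d (q + 1) (x + ρ.h (q + 1) (δb (q + 1) x)) +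
          ρ.g (q + 1) (ρ.f (q + 1) (δb (q + 1) x)) := by
    have h₁ := ρ.gf_dh_hd q (δb (q + 1) x)
    have h₂ := congrArg (ρ.h q) (sq q x)
    simp only [map_add, map_zero] at h₂ ⊢
    linear_combination (norm := abel) h₂ - h₁
  have f_chain (q : ℤ) (x : Cbig.X (q + 1)) : Csmall.d q (ρ.f (q + 1) (ψ (q + 1) x)) =
      ρ.f q (ψ q (Cbig.d q x + δb q x)) := by
    have key := conj_right q (ψ (q + 1) x)
    rw [ψr] at key
    rw [key, map_add (ψ q), ψl, map_add (ρ.f q), induced, add_zero, ρ.f_chain]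
  have g_chain (q : ℤ) (y : Csmall.X (q + 1 + 1)) :
      Cbig.d (q + 1) (φ (q + 1) (ρ.g (q + 1 + 1) y)) + δb (q + 1) (φ (q + 1) (ρ.g (q + 1 + 1) y)) =
        φ q (ρ.g (q + 1) (Csmall.d (q + 1) y)) := by
    have key := conj_left q (φ (q + 1) (ρ.g (q + 1 + 1) y))
    rw [φr, induced', map_zero, add_zero, ρ.g_chain] at key
    rw [← key, φl]
  have fg (q : ℤ) (y : Csmall.X (q + 1)) :
      ρ.f (q + 1) (ψ (q + 1) (φ q (ρ.g (q + 1) y))) = y := by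
    have key := ψl (q + 1) (φ q (ρ.g (q + 1) y))
    rw [hφ', ρ.hg, map_zero, add_zero] at key
    rw [key, fφ, ρ.fg]
  have homotopy (q : ℤ) (x : Cbig.X (q + 1)) :
      φ q (ρ.g (q + 1) (ρ.f (q + 1) (ψ (q + 1) x))) +
        (Cbig.d (q + 1) (ρ.h (q + 1) (ψ (q + 1) x)) + δb (q + 1) (ρ.h (q + 1) (ψ (q + 1) x))) +
        ρ.h q (ψ q (Cbig.d q x + δb q x)) = x := by
    have hx := ψr (q + 1) x
    generalize ψ (q + 1) x = z at hx ⊢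
    subst hx
    rw [← φh, ← φl q (Cbig.d (q + 1) _ + _), conj_left, conj_right, ← map_add (φ q),
      ← map_add (φ q)]
    conv_rhs => rw [← φl q (z + _)]
    congr 1
    have h₁ := congrArg (fun w => ρ.h q (δb q w)) (ρ.gf_dh_hd q z)
    have h₂ := ρ.gf_dh_hd q (δb (q + 1) (ρ.h (q + 1) z))
    have h₃ := congrArg (ρ.h q) (sq q (ρ.h (q + 1) z))
    have h₄ := ρ.gf_dh_hd q z
    simp only [map_add, map_zero] at h₁ h₃ ⊢
    linear_combination (norm := abel) h₁ + h₂ + h₄ - h₃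
  obtain ⟨g', hg'⟩ := exists_family_of_succ
    (F := fun q => Csmall.X q →ₗ[R] Cbig.X q) fun q => (φ q).comp (ρ.g (q + 1))
  have hg'' (q : ℤ) (y : Csmall.X (q + 1)) : g' (q + 1) y = φ q (ρ.g (q + 1) y) := by
    rw [hg']
    rfl
  have pred (q : ℤ) : ∃ p, q = p + 1 := ⟨q - 1, by ring⟩
  refine ⟨induced', induced, ⟨fun q => (ρ.f q).comp (ψ q), g', fun q => (ρ.h q).comp (ψ q),
    f_chain, ?_, ?_, ?_, ?_, ?_, ?_⟩, fun _ => rfl, hg', fun _ => rfl⟩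
  · intro q y
    obtain ⟨p, rfl⟩ := pred q
    change Cbig.d (p + 1) (g' (p + 1 + 1) y) + δb (p + 1) (g' (p + 1 + 1) y) =
      g' (p + 1) (Csmall.d (p + 1) y)
    rw [hg'', hg'']
    exact g_chain p y
  · intro q y
    obtain ⟨p, rfl⟩ := pred q
    change ρ.f (p + 1) (ψ (p + 1) (g' (p + 1) y)) = y
    rw [hg'']
    exact fg p y
  · intro q x
    refine Eq.trans ?_ (homotopy q x)
    rw [← hg'']
    rfl
  · intro q x
    change ρ.f (q + 1) (ψ (q + 1) (ρ.h q (ψ q x))) = 0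
    rw [ψh, ρ.fh]
  · intro q y
    obtain ⟨p, rfl⟩ := pred q
    change ρ.h (p + 1) (ψ (p + 1) (g' (p + 1) y)) = 0
    rw [hg'', ← φh, hφ', ρ.hg, map_zero]
  · intro q x
    change ρ.h (q + 1) (ψ (q + 1) (ρ.h q (ψ q x))) = 0
    rw [ψh, ρ.hh]
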